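/- arXiv:1907.03825 — 2 statements merged into one kernel-verified Lean document; each statement's English description precedes it below -/
import Mathlib

section
/- Let f : [a,b] → X have the property S*M on [a,b], let Z₁ = { t₁ ∈ [a₁,b₁] : the section f_{t₁} does not have the property S*M on [a₂,b₂] }, Z₂ = { t₂ ∈ [a₂,b₂] : the section f_{t₂} does not have the property S*M on [a₁,b₁] }, and Z = (Z₁ × [a₂,b₂]) ∪ ([a₁,b₁] × Z₂). Then the indicator function 𝟙_Z is McShane integrable on [a,b] with (M)∫_{[a,b]} 𝟙_Z = 0. -/
open Set MeasureTheory

variable {E : Type*} [MeasureSpace E] [PseudoMetricSpace E] [Preorder E]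
variable {X : Type*} [NormedAddCommGroup X] [NormedSpace ℝ X]

/-- The closed interval of a tagged item `(t, p, q)` is `[p, q]` (the tag is `t`). -/
def itemBox (x : E × E × E) : Set E := Set.Icc x.2.1 x.2.2

/-- `[p,q]` is a closed non-degenerate subinterval of `K`. -/
def IsSubinterval (K : Set E) (p q : E) : Prop :=
  Set.Icc p q ⊆ K ∧ (interior (Set.Icc p q)).Nonempty

/-- `P` is an `𝓜`-partition of `K`: a finite collection of tagged pairwise
non-overlapping closed non-degenerate subintervals of `K` covering `K`, with tags in `K`. -/
def IsMPartition (K : Set E) (P : Finset (E × E × E)) : Prop :=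
  (∀ x ∈ P, x.1 ∈ K ∧ IsSubinterval K x.2.1 x.2.2) ∧
  (∀ x ∈ P, ∀ y ∈ P, x ≠ y → interior (itemBox x) ∩ interior (itemBox y) = ∅) ∧
  (⋃ x ∈ P, itemBox x) = K

/-- `𝓗𝓚`-partition: an `𝓜`-partition each of whose tags belongs to its interval. -/
def IsHKPartition (K : Set E) (P : Finset (E × E × E)) : Prop :=
  IsMPartition K P ∧ ∀ x ∈ P, x.1 ∈ itemBox x

/-- A gauge on `K`: positive on `K`. -/
def IsGauge (K : Set E) (δ : E → ℝ) : Prop := ∀ t ∈ K, 0 < δ t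

/-- A tagged partition is `δ`-fine if each interval lies in the open ball
around its tag of radius `δ(tag)`. -/
def IsFine (δ : E → ℝ) (P : Finset (E × E × E)) : Prop :=
  ∀ x ∈ P, itemBox x ⊆ Metric.ball x.1 (δ x.1)

/-- `f` is McShane integrable on `K` with integral `v`. -/
def HasMcShaneIntegral (K : Set E) (f : E → X) (v : X) : Prop :=
  ∀ ε > 0, ∃ δ : E → ℝ, IsGauge K δ ∧
    ∀ P : Finset (E × E × E), IsMPartition K P → IsFine δ P →
      ‖(∑ x ∈ P, (volume (itemBox x)).toReal • f x.1) - v‖ < ε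

/-- `f` is Henstock–Kurzweil integrable on `K` with integral `v`. -/
def HasHKIntegral (K : Set E) (f : E → X) (v : X) : Prop :=
  ∀ ε > 0, ∃ δ : E → ℝ, IsGauge K δ ∧
    ∀ P : Finset (E × E × E), IsHKPartition K P → IsFine δ P →
      ‖(∑ x ∈ P, (volume (itemBox x)).toReal • f x.1) - v‖ < ε

/-- An additive interval function on the non-degenerate closed subintervals of `K`
(an interval is recorded by its pair of corners). -/
def IsAdditiveIntervalFun (K : Set E) (F : E × E → X) : Prop :=
  ∀ p q r s u w : E, IsSubinterval K p q → IsSubinterval K r s → IsSubinterval K u w →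
    interior (Set.Icc p q) ∩ interior (Set.Icc r s) = ∅ →
    Set.Icc p q ∪ Set.Icc r s = Set.Icc u w →
    F (u, w) = F (p, q) + F (r, s)

/-- `f` is strongly McShane integrable on `[a,b]` with `(M)∫_{[a,b]} f = v`. -/
def HasStrongMcShaneIntegral (a b : E) (f : E → X) (v : X) : Prop :=
  ∃ F : E × E → X, IsAdditiveIntervalFun (Set.Icc a b) F ∧ F (a, b) = v ∧
    ∀ ε > 0, ∃ δ : E → ℝ, IsGauge (Set.Icc a b) δ ∧
      ∀ P : Finset (E × E × E), IsMPartition (Set.Icc a b) P → IsFine δ P →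
        ∑ x ∈ P, ‖(volume (itemBox x)).toReal • f x.1 - F (x.2.1, x.2.2)‖ < ε

/-- `f` is strongly Henstock–Kurzweil integrable on `[a,b]` with `(HK)∫_{[a,b]} f = v`. -/
def HasStrongHKIntegral (a b : E) (f : E → X) (v : X) : Prop :=
  ∃ F : E × E → X, IsAdditiveIntervalFun (Set.Icc a b) F ∧ F (a, b) = v ∧
    ∀ ε > 0, ∃ δ : E → ℝ, IsGauge (Set.Icc a b) δ ∧
      ∀ P : Finset (E × E × E), IsHKPartition (Set.Icc a b) P → IsFine δ P →
        ∑ x ∈ P, ‖(volume (itemBox x)).toReal • f x.1 - F (x.2.1, x.2.2)‖ < ε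

/-- Property `𝓢*𝓜` on `[a,b]`. -/
def PropSM (a b : E) (f : E → X) : Prop :=
  ∀ ε > 0, ∃ δ : E → ℝ, IsGauge (Set.Icc a b) δ ∧
    ∀ P Q : Finset (E × E × E),
      IsMPartition (Set.Icc a b) P → IsFine δ P →
      IsMPartition (Set.Icc a b) Q → IsFine δ Q →
      ∑ x ∈ P, ∑ y ∈ Q, ‖f x.1 - f y.1‖ * (volume (itemBox x ∩ itemBox y)).toReal < ε

/-- Property `𝓢*𝓗𝓚` on `[a,b]`. -/
def PropSHK (a b : E) (f : E → X) : Prop :=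
  ∀ ε > 0, ∃ δ : E → ℝ, IsGauge (Set.Icc a b) δ ∧
    ∀ P Q : Finset (E × E × E),
      IsHKPartition (Set.Icc a b) P → IsFine δ P →
      IsHKPartition (Set.Icc a b) Q → IsFine δ Q →
      ∑ x ∈ P, ∑ y ∈ Q, ‖f x.1 - f y.1‖ * (volume (itemBox x ∩ itemBox y)).toReal < ε

lemma volume_itemBox_ne_top {F : Type*} [MeasureSpace F] [TopologicalSpace F] [Preorder F]
    [CompactIccSpace F] [IsFiniteMeasureOnCompacts (volume : Measure F)] (x : F × F × F) :
    volume (itemBox x) ≠ ⊤ :=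
  (isCompact_Icc.measure_lt_top).ne

lemma IsMPartition.aedisjoint {K : Set (ℝ × ℝ)} {P : Finset ((ℝ × ℝ) × (ℝ × ℝ) × (ℝ × ℝ))}
    (hP : IsMPartition K P) :
    (P : Set ((ℝ × ℝ) × (ℝ × ℝ) × (ℝ × ℝ))).Pairwise
      (Function.onFun (AEDisjoint volume) itemBox) := by
  intro x hx y hy hxy
  have hconv : Convex ℝ (itemBox x ∩ itemBox y) :=
    (convex_Icc x.2.1 x.2.2).inter (convex_Icc y.2.1 y.2.2)
  refine measure_mono_null ?_ (hconv.addHaar_frontier volume)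
  have hint : interior (itemBox x ∩ itemBox y) = ∅ := by
    rw [interior_inter]; exact hP.2.1 x hx y hy hxy
  rw [frontier, hint, sdiff_empty]
  exact subset_closure

/-- The indicator function of a Lebesgue null set has McShane integral zero. -/
lemma hasMcShaneIntegral_indicator_of_null (K Z : Set (ℝ × ℝ)) (hZ : volume Z = 0) :
    HasMcShaneIntegral K (Z.indicator fun _ => (1 : ℝ)) 0 := by
  classical
  intro ε hε
  obtain ⟨U, hZU, hU, hUε⟩ := Z.exists_isOpen_lt_of_lt (ENNReal.ofReal ε)
    (by rw [hZ]; exact ENNReal.ofReal_pos.2 hε)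
  have hball : ∀ t : ℝ × ℝ, ∃ r > 0, t ∈ Z → Metric.ball t r ⊆ U := fun t => by
    by_cases ht : t ∈ Z
    · obtain ⟨r, hr, h⟩ := Metric.isOpen_iff.1 hU t (hZU ht)
      exact ⟨r, hr, fun _ => h⟩
    · exact ⟨1, one_pos, fun h => absurd h ht⟩
  choose δ hδ hδU using hball
  refine ⟨δ, fun t _ => hδ t, fun P hP hfine => ?_⟩
  have hsum : ∑ x ∈ P, (volume (itemBox x)).toReal • Z.indicator (fun _ => (1 : ℝ)) x.1
      = (volume (⋃ x ∈ P.filter (fun x => x.1 ∈ Z), itemBox x)).toReal := by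
    rw [measure_biUnion_finset₀ (hP.aedisjoint.mono (Finset.coe_subset.2 (Finset.filter_subset _ P)))
      (fun x _ => measurableSet_Icc.nullMeasurableSet),
      ENNReal.toReal_sum (fun x _ => volume_itemBox_ne_top x), Finset.sum_filter]
    refine Finset.sum_congr rfl fun x _ => ?_
    by_cases hx : x.1 ∈ Z <;> simp [hx]
  rw [hsum, sub_zero, Real.norm_of_nonneg ENNReal.toReal_nonneg]
  refine ENNReal.toReal_lt_of_lt_ofReal (lt_of_le_of_lt (measure_mono ?_) hUε)
  simp only [Finset.mem_filter, iUnion_subset_iff, and_imp]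
  exact fun x hx hxZ => (hfine x hx).trans (hδU x.1 hxZ)

lemma exists_mem_Icc_succ_of_mem_Icc (g : ℕ → ℝ) (x : ℝ) :
    ∀ n : ℕ, x ∈ Icc (g 0) (g (n + 1)) → ∃ i < n + 1, x ∈ Icc (g i) (g (i + 1))
  | 0, hx => ⟨0, one_pos, hx⟩
  | n + 1, hx => by
    rcases le_total x (g (n + 1)) with h | h
    · obtain ⟨i, hi, hxi⟩ := exists_mem_Icc_succ_of_mem_Icc g x n ⟨hx.1, h⟩
      exact ⟨i, by omega, hxi⟩
    · exact ⟨n + 1, by omega, h, hx.2⟩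

/-- Every gauge on `[a, b]` has a fine partition; moreover a compact set covered by the balls
around points of `N` can be covered by the items with tags in `N`. -/
lemma exists_isFine_isMPartition_covering {a b : ℝ} (hab : a < b) (δ : ℝ → ℝ)
    (hδ : IsGauge (Icc a b) δ) (N : Set ℝ) (hN : N ⊆ Icc a b) (C : Set ℝ) (hC : IsCompact C)
    (hCN : C ⊆ ⋃ t ∈ N, Metric.ball t (δ t)) :
    ∃ P : Finset (ℝ × ℝ × ℝ), IsMPartition (Icc a b) P ∧ IsFine δ P ∧
      ∀ x ∈ P, (itemBox x ∩ C).Nonempty → x.1 ∈ N := by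
  classical
  obtain ⟨r, hr, hrC⟩ := lebesgue_number_lemma_of_metric (c := fun t : N => Metric.ball (t : ℝ) (δ t))
    hC (fun _ => Metric.isOpen_ball) (by simpa [iUnion_subtype] using hCN)
  obtain ⟨r', hr', hrK⟩ := lebesgue_number_lemma_of_metric
    (c := fun t : Icc a b => Metric.ball (t : ℝ) (δ t))
    (isCompact_Icc (a := a) (b := b)) (fun _ => Metric.isOpen_ball)
    (fun t ht => mem_iUnion.2 ⟨⟨t, ht⟩, Metric.mem_ball_self (hδ t ht)⟩)
  obtain ⟨n, hn⟩ := exists_nat_gt ((b - a) / min r r')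
  have hm : 0 < min r r' := lt_min hr hr'
  set h : ℝ := (b - a) / (n + 1) with hh
  have hn1 : (0 : ℝ) < n + 1 := by positivity
  have hpos : 0 < h := div_pos (sub_pos.2 hab) hn1
  have hsmall : h < min r r' := by
    rw [hh, div_lt_iff₀ hn1]
    rw [div_lt_iff₀ hm] at hn
    nlinarith
  set g : ℕ → ℝ := fun i => a + i * h with hg
  have hg0 : g 0 = a := by simp [hg]
  have hgn : g (n + 1) = b := by simp only [hg, hh]; push_cast; field_simp; ring
  have hgs : ∀ i, g (i + 1) = g i + h := fun i => by simp only [hg]; push_cast; ring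
  have hmono : Monotone g := monotone_nat_of_le_succ fun i => by rw [hgs]; linarith
  have hcell : ∀ i < n + 1, Icc (g i) (g (i + 1)) ⊆ Icc a b := fun i hi =>
    Icc_subset_Icc (hg0 ▸ hmono (Nat.zero_le i)) (hgn ▸ hmono (by omega))
  have hdist : ∀ i, ∀ x ∈ Icc (g i) (g (i + 1)), Icc (g i) (g (i + 1)) ⊆ Metric.ball x (min r r') := by
    intro i x hx y hy
    rw [hgs] at hx hy
    rw [Metric.mem_ball, Real.dist_eq, abs_lt]
    constructor <;> linarith [hx.1, hx.2, hy.1, hy.2]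
  have htag : ∀ i, ∃ t, i < n + 1 → t ∈ Icc a b ∧ Icc (g i) (g (i + 1)) ⊆ Metric.ball t (δ t) ∧
      ((Icc (g i) (g (i + 1)) ∩ C).Nonempty → t ∈ N) := by
    intro i
    by_cases hi : i < n + 1
    · by_cases hne : (Icc (g i) (g (i + 1)) ∩ C).Nonempty
      · obtain ⟨x, hx, hxC⟩ := hne
        obtain ⟨t, ht⟩ := hrC x hxC
        exact ⟨t, fun _ => ⟨hN t.2, (hdist i x hx).trans
          ((Metric.ball_subset_ball (min_le_left _ _)).trans ht), fun _ => t.2⟩⟩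
      · have hx : g i ∈ Icc (g i) (g (i + 1)) := left_mem_Icc.2 (hmono (Nat.le_succ i))
        obtain ⟨t, ht⟩ := hrK (g i) (hcell i hi hx)
        exact ⟨t, fun _ => ⟨t.2, (hdist i _ hx).trans
          ((Metric.ball_subset_ball (min_le_right _ _)).trans ht), fun h => absurd h hne⟩⟩
    · exact ⟨0, fun h => absurd h hi⟩
  choose τ hτ using htag
  have hmem : ∀ x, x ∈ (Finset.range (n + 1)).image (fun i => (τ i, g i, g (i + 1))) ↔
      ∃ i < n + 1, (τ i, g i, g (i + 1)) = x := by simp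
  have hlt : ∀ i j, i < j → Ioo (g i) (g (i + 1)) ∩ Ioo (g j) (g (j + 1)) = ∅ := by
    intro i j hij
    refine eq_empty_of_forall_notMem fun x hx => ?_
    have := hmono (Nat.succ_le_of_lt hij)
    exact absurd (hx.1.2.trans_le (this.trans hx.2.1.le)) (lt_irrefl _)
  refine ⟨(Finset.range (n + 1)).image (fun i => (τ i, g i, g (i + 1))), ⟨?_, ?_, ?_⟩, ?_, ?_⟩
  · intro x hx
    obtain ⟨i, hi, rfl⟩ := (hmem x).1 hx
    refine ⟨(hτ i hi).1, hcell i hi, ?_⟩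
    rw [interior_Icc, nonempty_Ioo, hgs]
    linarith
  · intro x hx y hy hxy
    obtain ⟨i, hi, rfl⟩ := (hmem x).1 hx
    obtain ⟨j, hj, rfl⟩ := (hmem y).1 hy
    simp only [itemBox, interior_Icc]
    rcases lt_trichotomy i j with h | rfl | h
    · exact hlt i j h
    · exact absurd rfl hxy
    · rw [inter_comm]; exact hlt j i h
  · refine Subset.antisymm (iUnion₂_subset fun x hx => ?_) fun x hx => ?_
    · obtain ⟨i, hi, rfl⟩ := (hmem x).1 hx
      exact hcell i hi
    · obtain ⟨i, hi, hxi⟩ := exists_mem_Icc_succ_of_mem_Icc g x n (by rwa [hg0, hgn])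
      exact mem_iUnion₂.2 ⟨_, (hmem _).2 ⟨i, hi, rfl⟩, hxi⟩
  · intro x hx
    obtain ⟨i, hi, rfl⟩ := (hmem x).1 hx
    exact (hτ i hi).2.1
  · intro x hx
    obtain ⟨i, hi, rfl⟩ := (hmem x).1 hx
    exact (hτ i hi).2.2

/-- The tagged partition of a rectangle obtained from a partition `R` of the first side and, for
every tag `t` of `R`, a partition `P t` of the second side. -/
def prodPartition (R : Finset (ℝ × ℝ × ℝ)) (P : ℝ → Finset (ℝ × ℝ × ℝ)) :
    Finset ((ℝ × ℝ) × (ℝ × ℝ) × (ℝ × ℝ)) :=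
  (R.sigma fun x => P x.1).map
    ⟨fun z => ((z.1.1, z.2.1), (z.1.2.1, z.2.2.1), (z.1.2.2, z.2.2.2)), by
      rintro ⟨⟨_, _, _⟩, _, _, _⟩ ⟨⟨_, _, _⟩, _, _, _⟩ h
      simp only [Prod.mk.injEq] at h
      obtain ⟨⟨rfl, rfl⟩, ⟨rfl, rfl⟩, rfl, rfl⟩ := h
      rfl⟩

lemma mem_prodPartition {R : Finset (ℝ × ℝ × ℝ)} {P : ℝ → Finset (ℝ × ℝ × ℝ)}
    {z : (ℝ × ℝ) × (ℝ × ℝ) × (ℝ × ℝ)} :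
    z ∈ prodPartition R P ↔ ∃ x ∈ R, ∃ y ∈ P x.1,
      z = ((x.1, y.1), (x.2.1, y.2.1), (x.2.2, y.2.2)) := by
  simp only [prodPartition, Finset.mem_map, Finset.mem_sigma]
  constructor
  · rintro ⟨⟨x, y⟩, ⟨hx, hy⟩, rfl⟩
    exact ⟨x, hx, y, hy, rfl⟩
  · rintro ⟨x, hx, y, hy, rfl⟩
    exact ⟨⟨x, y⟩, ⟨hx, hy⟩, rfl⟩

lemma sum_prodPartition (R : Finset (ℝ × ℝ × ℝ)) (P : ℝ → Finset (ℝ × ℝ × ℝ))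
    (F : (ℝ × ℝ) × (ℝ × ℝ) × (ℝ × ℝ) → ℝ) :
    ∑ z ∈ prodPartition R P, F z =
      ∑ x ∈ R, ∑ y ∈ P x.1, F ((x.1, y.1), (x.2.1, y.2.1), (x.2.2, y.2.2)) := by
  rw [prodPartition, Finset.sum_map, Finset.sum_sigma]
  rfl

lemma itemBox_prodMk (x y : ℝ × ℝ × ℝ) :
    itemBox (((x.1, y.1), (x.2.1, y.2.1), (x.2.2, y.2.2)) : (ℝ × ℝ) × (ℝ × ℝ) × (ℝ × ℝ)) =
      itemBox x ×ˢ itemBox y :=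
  (Icc_prod_Icc _ _ _ _).symm

lemma IsMPartition.prodPartition {a₁ b₁ a₂ b₂ : ℝ} {R : Finset (ℝ × ℝ × ℝ)}
    {P : ℝ → Finset (ℝ × ℝ × ℝ)} (hR : IsMPartition (Icc a₁ b₁) R)
    (hP : ∀ t ∈ Icc a₁ b₁, IsMPartition (Icc a₂ b₂) (P t)) :
    IsMPartition (Icc ((a₁, a₂) : ℝ × ℝ) (b₁, b₂)) (prodPartition R P) := by
  refine ⟨?_, ?_, ?_⟩
  · intro z hz
    obtain ⟨x, hx, y, hy, rfl⟩ := mem_prodPartition.1 hz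
    obtain ⟨hxt, hxs, hxi⟩ := hR.1 x hx
    obtain ⟨hyt, hys, hyi⟩ := (hP x.1 hxt).1 y hy
    refine ⟨by rw [← Icc_prod_Icc]; exact ⟨hxt, hyt⟩, ?_, ?_⟩
    · rw [← Icc_prod_Icc, ← Icc_prod_Icc]
      exact prod_mono hxs hys
    · rw [← Icc_prod_Icc, interior_prod_eq]
      exact hxi.prod hyi
  · intro z hz w hw hzw
    obtain ⟨x, hx, y, hy, rfl⟩ := mem_prodPartition.1 hz
    obtain ⟨x', hx', y', hy', rfl⟩ := mem_prodPartition.1 hw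
    rw [itemBox_prodMk, itemBox_prodMk, interior_prod_eq, interior_prod_eq, prod_inter_prod]
    by_cases hxx : x = x'
    · subst hxx
      have hyy : y ≠ y' := by rintro rfl; exact hzw rfl
      rw [(hP x.1 (hR.1 x hx).1).2.1 y hy y' hy' hyy, prod_empty]
    · rw [hR.2.1 x hx x' hx' hxx, empty_prod]
  · rw [← Icc_prod_Icc]
    ext ⟨u, v⟩
    constructor
    · intro h
      obtain ⟨z, hz, huv⟩ := mem_iUnion₂.1 h
      obtain ⟨x, hx, y, hy, rfl⟩ := mem_prodPartition.1 hz
      rw [itemBox_prodMk] at huv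
      exact ⟨(hR.1 x hx).2.1 huv.1, ((hP x.1 (hR.1 x hx).1).1 y hy).2.1 huv.2⟩
    · rintro ⟨hu, hv⟩
      rw [← hR.2.2] at hu
      obtain ⟨x, hx, hux⟩ := mem_iUnion₂.1 hu
      rw [← (hP x.1 (hR.1 x hx).1).2.2] at hv
      obtain ⟨y, hy, hvy⟩ := mem_iUnion₂.1 hv
      exact mem_iUnion₂.2 ⟨_, mem_prodPartition.2 ⟨x, hx, y, hy, rfl⟩,
        by rw [itemBox_prodMk]; exact ⟨hux, hvy⟩⟩

lemma IsFine.prodPartition {δ : ℝ × ℝ → ℝ} {ρ : ℝ → ℝ} {R : Finset (ℝ × ℝ × ℝ)}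
    {P : ℝ → Finset (ℝ × ℝ × ℝ)} (hR : IsFine ρ R)
    (hP : ∀ x ∈ R, IsFine (fun s => δ (x.1, s)) (P x.1))
    (hρ : ∀ x ∈ R, ∀ y ∈ P x.1, ρ x.1 ≤ δ (x.1, y.1)) :
    IsFine δ (prodPartition R P) := by
  intro z hz
  obtain ⟨x, hx, y, hy, rfl⟩ := mem_prodPartition.1 hz
  rw [itemBox_prodMk, ← ball_prod_same]
  exact prod_mono ((hR x hx).trans (Metric.ball_subset_ball (hρ x hx y hy))) (hP x hx y hy)

lemma Finset.exists_pos_forall_le {ι : Type*} (s : Finset ι) (g : ι → ℝ) (hg : ∀ i ∈ s, 0 < g i) :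
    ∃ r > 0, ∀ i ∈ s, r ≤ g i := by
  rcases s.eq_empty_or_nonempty with rfl | hs
  · exact ⟨1, one_pos, by simp⟩
  · obtain ⟨i, hi, hmin⟩ := s.exists_min_image g hs
    exact ⟨g i, hg i hi, hmin⟩

/-- The double sum in the definition of `PropSM`. -/
noncomputable def oscSum {F : Type*} [MeasureSpace F] [Preorder F] (f : F → X)
    (P Q : Finset (F × F × F)) : ℝ :=
  ∑ x ∈ P, ∑ y ∈ Q, ‖f x.1 - f y.1‖ * (volume (itemBox x ∩ itemBox y)).toReal

lemma oscSum_nonneg {Y F : Type*} [NormedAddCommGroup Y] [MeasureSpace F] [Preorder F]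
    (f : F → Y) (P Q : Finset (F × F × F)) : 0 ≤ oscSum f P Q :=
  Finset.sum_nonneg fun _ _ => Finset.sum_nonneg fun _ _ => by positivity

lemma le_oscSum_prodPartition {Y : Type*} [NormedAddCommGroup Y] (f : ℝ × ℝ → Y) (R : Finset (ℝ × ℝ × ℝ))
    (P Q : ℝ → Finset (ℝ × ℝ × ℝ)) :
    ∑ x ∈ R, (volume (itemBox x)).toReal * oscSum (fun s => f (x.1, s)) (P x.1) (Q x.1) ≤
      oscSum f (prodPartition R P) (prodPartition R Q) := by
  rw [oscSum, sum_prodPartition]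
  refine Finset.sum_le_sum fun x hx => ?_
  rw [oscSum, Finset.mul_sum]
  refine Finset.sum_le_sum fun y _ => ?_
  rw [sum_prodPartition, Finset.mul_sum]
  refine le_trans (Finset.sum_le_sum fun y' _ => le_of_eq ?_) (Finset.single_le_sum
    (f := fun x' => ∑ y' ∈ Q x'.1, ‖f (x.1, y.1) - f (x'.1, y'.1)‖ *
      (volume (itemBox (((x.1, y.1), (x.2.1, y.2.1), (x.2.2, y.2.2)) :
          (ℝ × ℝ) × (ℝ × ℝ) × (ℝ × ℝ)) ∩
        itemBox ((x'.1, y'.1), (x'.2.1, y'.2.1), (x'.2.2, y'.2.2)))).toReal)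
    (fun _ _ => Finset.sum_nonneg fun _ _ => by positivity) hx)
  rw [itemBox_prodMk, itemBox_prodMk, prod_inter_prod, inter_self, Measure.volume_eq_prod,
    Measure.prod_prod, ENNReal.toReal_mul]
  ring

/-- The parameters whose sections violate the `PropSM` condition for a fixed `ε` form a null set. -/
lemma volume_setOf_forall_gauge_le_oscSum_eq_zero {Y : Type*} [NormedAddCommGroup Y]
    {a₁ b₁ a₂ b₂ : ℝ} (hab₁ : a₁ < b₁)
    (hab₂ : a₂ < b₂) {f : ℝ × ℝ → Y} (hf : PropSM ((a₁, a₂) : ℝ × ℝ) (b₁, b₂) f) {ε : ℝ}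
    (hε : 0 < ε) :
    volume {t | t ∈ Icc a₁ b₁ ∧ ∀ δ : ℝ → ℝ, IsGauge (Icc a₂ b₂) δ →
      ∃ P Q : Finset (ℝ × ℝ × ℝ), IsMPartition (Icc a₂ b₂) P ∧ IsFine δ P ∧
        IsMPartition (Icc a₂ b₂) Q ∧ IsFine δ Q ∧ ε ≤ oscSum (fun s => f (t, s)) P Q} = 0 := by
  classical
  set N := {t | t ∈ Icc a₁ b₁ ∧ ∀ δ : ℝ → ℝ, IsGauge (Icc a₂ b₂) δ →
      ∃ P Q : Finset (ℝ × ℝ × ℝ), IsMPartition (Icc a₂ b₂) P ∧ IsFine δ P ∧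
        IsMPartition (Icc a₂ b₂) Q ∧ IsFine δ Q ∧ ε ≤ oscSum (fun s => f (t, s)) P Q}
  have hN : N ⊆ Icc a₁ b₁ := fun t ht => ht.1
  refine le_antisymm (ENNReal.le_of_forall_pos_le_add fun η hη _ => ?_) zero_le
  have hη' : (0 : ℝ) < η := hη
  obtain ⟨δ, hδ, hosc⟩ := hf (η * ε) (mul_pos hη' hε)
  have hchoice : ∀ t, ∃ (P Q : Finset (ℝ × ℝ × ℝ)) (r : ℝ), t ∈ Icc a₁ b₁ →
      IsMPartition (Icc a₂ b₂) P ∧ IsFine (fun s => δ (t, s)) P ∧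
      IsMPartition (Icc a₂ b₂) Q ∧ IsFine (fun s => δ (t, s)) Q ∧
      (t ∈ N → ε ≤ oscSum (fun s => f (t, s)) P Q) ∧
      0 < r ∧ (∀ y ∈ P, r ≤ δ (t, y.1)) ∧ ∀ y ∈ Q, r ≤ δ (t, y.1) := by
    intro t
    by_cases ht : t ∈ Icc a₁ b₁
    · have hgauge : IsGauge (Icc a₂ b₂) fun s => δ (t, s) := fun s hs =>
        hδ (t, s) (by rw [← Icc_prod_Icc]; exact ⟨ht, hs⟩)
      obtain ⟨P, Q, hP, hPf, hQ, hQf, hPQ⟩ : ∃ P Q : Finset (ℝ × ℝ × ℝ),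
          IsMPartition (Icc a₂ b₂) P ∧ IsFine (fun s => δ (t, s)) P ∧
          IsMPartition (Icc a₂ b₂) Q ∧ IsFine (fun s => δ (t, s)) Q ∧
          (t ∈ N → ε ≤ oscSum (fun s => f (t, s)) P Q) := by
        by_cases htN : t ∈ N
        · obtain ⟨P, Q, hP, hPf, hQ, hQf, hPQ⟩ := htN.2 _ hgauge
          exact ⟨P, Q, hP, hPf, hQ, hQf, fun _ => hPQ⟩
        · obtain ⟨P, hP, hPf, -⟩ := exists_isFine_isMPartition_covering hab₂ _ hgauge ∅
            (empty_subset _) ∅ isCompact_empty (empty_subset _)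
          exact ⟨P, P, hP, hPf, hP, hPf, fun h => absurd h htN⟩
      obtain ⟨r, hr, hrle⟩ := (P ∪ Q).exists_pos_forall_le (fun y => δ (t, y.1)) fun y hy =>
        hgauge y.1 ((Finset.mem_union.1 hy).elim (fun h => (hP.1 y h).1) fun h => (hQ.1 y h).1)
      exact ⟨P, Q, r, fun _ => ⟨hP, hPf, hQ, hQf, hPQ, hr,
        fun y hy => hrle y (Finset.mem_union_left _ hy),
        fun y hy => hrle y (Finset.mem_union_right _ hy)⟩⟩
    · exact ⟨∅, ∅, 0, fun h => absurd h ht⟩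
  choose P Q ρ h using hchoice
  have hρ : IsGauge (Icc a₁ b₁) ρ := fun t ht => (h t ht).2.2.2.2.2.1
  have hopen : IsOpen (⋃ t ∈ N, Metric.ball t (ρ t)) :=
    isOpen_biUnion fun _ _ => Metric.isOpen_ball
  rw [zero_add]
  by_contra! hlt
  have hsub : N ⊆ (⋃ t ∈ N, Metric.ball t (ρ t)) ∩ Icc a₁ b₁ := fun t ht =>
    ⟨mem_iUnion₂.2 ⟨t, ht, Metric.mem_ball_self (hρ t (hN ht))⟩, hN ht⟩
  obtain ⟨C, hCsub, hC, hCη⟩ := (hopen.measurableSet.inter measurableSet_Icc).exists_lt_isCompact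
    (hlt.trans_le (measure_mono hsub))
  obtain ⟨R, hR, hRf, hRC⟩ := exists_isFine_isMPartition_covering hab₁ ρ hρ N hN C hC
    (hCsub.trans inter_subset_left)
  have hfine : ∀ S : ℝ → Finset (ℝ × ℝ × ℝ),
      (∀ t ∈ Icc a₁ b₁, IsMPartition (Icc a₂ b₂) (S t) ∧ IsFine (fun s => δ (t, s)) (S t) ∧
        ∀ y ∈ S t, ρ t ≤ δ (t, y.1)) →
      IsMPartition (Icc ((a₁, a₂) : ℝ × ℝ) (b₁, b₂)) (prodPartition R S) ∧
        IsFine δ (prodPartition R S) := fun S hS =>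
    ⟨hR.prodPartition fun t ht => (hS t ht).1,
      hRf.prodPartition (fun x hx => (hS x.1 (hR.1 x hx).1).2.1)
        fun x hx => (hS x.1 (hR.1 x hx).1).2.2⟩
  obtain ⟨hPm, hPf⟩ := hfine P fun t ht =>
    ⟨(h t ht).1, (h t ht).2.1, (h t ht).2.2.2.2.2.2.1⟩
  obtain ⟨hQm, hQf⟩ := hfine Q fun t ht =>
    ⟨(h t ht).2.2.1, (h t ht).2.2.2.1, (h t ht).2.2.2.2.2.2.2⟩
  have hlower : (∑ x ∈ R with x.1 ∈ N, (volume (itemBox x)).toReal) * ε ≤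
      oscSum f (prodPartition R P) (prodPartition R Q) := by
    refine le_trans ?_ (le_oscSum_prodPartition f R P Q)
    rw [Finset.sum_mul]
    refine (Finset.sum_le_sum fun x hx => ?_).trans (Finset.sum_le_sum_of_subset_of_nonneg
      (Finset.filter_subset _ R) fun x _ _ => mul_nonneg ENNReal.toReal_nonneg
        (oscSum_nonneg _ _ _))
    obtain ⟨hxR, hxN⟩ := Finset.mem_filter.1 hx
    exact mul_le_mul_of_nonneg_left ((h x.1 (hN hxN)).2.2.2.2.1 hxN) ENNReal.toReal_nonneg
  have hupper : oscSum f (prodPartition R P) (prodPartition R Q) < η * ε :=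
    hosc _ _ hPm hPf hQm hQf
  have hlt' : ∑ x ∈ R with x.1 ∈ N, (volume (itemBox x)).toReal < η :=
    lt_of_mul_lt_mul_right (hlower.trans_lt hupper) hε.le
  rw [← ENNReal.toReal_sum fun x _ => volume_itemBox_ne_top x] at hlt'
  have hcover : C ⊆ ⋃ x ∈ R.filter (fun x => x.1 ∈ N), itemBox x := by
    intro u hu
    have huI := (hCsub hu).2
    rw [← hR.2.2] at huI
    obtain ⟨x, hx, hux⟩ := mem_iUnion₂.1 huI
    exact mem_iUnion₂.2 ⟨x, Finset.mem_filter.2 ⟨hx, hRC x hx ⟨u, hux, hu⟩⟩, hux⟩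
  have hle : volume C ≤ ∑ x ∈ R with x.1 ∈ N, volume (itemBox x) :=
    (measure_mono hcover).trans (measure_biUnion_finset_le _ _)
  have hfin : ∑ x ∈ R with x.1 ∈ N, volume (itemBox x) ≠ ⊤ :=
    ENNReal.sum_ne_top.2 fun x _ => volume_itemBox_ne_top x
  have hlt'' : ∑ x ∈ R with x.1 ∈ N, volume (itemBox x) < η := by
    rw [← ENNReal.ofReal_coe_nnreal]
    exact (ENNReal.lt_ofReal_iff_toReal_lt hfin).2 hlt'
  exact absurd (hCη.trans_le hle) hlt''.not_gt

/-- For a function with `PropSM` on a rectangle, almost every section has `PropSM`. -/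
lemma PropSM.volume_setOf_not_section_eq_zero {Y : Type*} [NormedAddCommGroup Y]
    {a₁ b₁ a₂ b₂ : ℝ} (hab₁ : a₁ < b₁)
    (hab₂ : a₂ < b₂) {f : ℝ × ℝ → Y} (hf : PropSM ((a₁, a₂) : ℝ × ℝ) (b₁, b₂) f) :
    volume {t | t ∈ Icc a₁ b₁ ∧ ¬ PropSM a₂ b₂ (fun s => f (t, s))} = 0 := by
  refine measure_mono_null ?_ (measure_iUnion_null fun k : ℕ =>
    volume_setOf_forall_gauge_le_oscSum_eq_zero hab₁ hab₂ hf (Nat.one_div_pos_of_nat (n := k)))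
  rintro t ⟨ht, hbad⟩
  simp only [PropSM, not_forall, not_exists, not_and, exists_prop, not_lt] at hbad
  obtain ⟨ε, hε, hbad⟩ := hbad
  obtain ⟨k, hk⟩ := exists_nat_one_div_lt hε
  refine mem_iUnion.2 ⟨k, ht, fun δ hδ => ?_⟩
  obtain ⟨P, Q, hP, hPf, hQ, hQf, hPQ⟩ := hbad δ hδ
  exact ⟨P, Q, hP, hPf, hQ, hQf, hk.le.trans hPQ⟩

/-- Interchange of the coordinates in every item of a tagged partition. -/
def swapItem : ((ℝ × ℝ) × (ℝ × ℝ) × (ℝ × ℝ)) ↪ (ℝ × ℝ) × (ℝ × ℝ) × (ℝ × ℝ) :=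
  ⟨Prod.map Prod.swap (Prod.map Prod.swap Prod.swap),
    Prod.swap_injective.prodMap (Prod.swap_injective.prodMap Prod.swap_injective)⟩

lemma itemBox_swapItem (z : (ℝ × ℝ) × (ℝ × ℝ) × (ℝ × ℝ)) :
    itemBox (swapItem z) = Prod.swap ⁻¹' itemBox z := by
  ext u
  exact and_congr (and_comm) (and_comm)

lemma interior_preimage_swap (s : Set (ℝ × ℝ)) :
    interior (Prod.swap ⁻¹' s) = Prod.swap ⁻¹' interior s :=
  ((Homeomorph.prodComm ℝ ℝ).preimage_interior s).symm

lemma Icc_prod_swap (a₁ b₁ a₂ b₂ : ℝ) :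
    Icc ((a₂, a₁) : ℝ × ℝ) (b₂, b₁) = Prod.swap ⁻¹' Icc ((a₁, a₂) : ℝ × ℝ) (b₁, b₂) := by
  ext u
  exact and_congr (and_comm) (and_comm)

lemma IsMPartition.map_swapItem {K : Set (ℝ × ℝ)} {P : Finset ((ℝ × ℝ) × (ℝ × ℝ) × (ℝ × ℝ))}
    (hP : IsMPartition K P) : IsMPartition (Prod.swap ⁻¹' K) (P.map swapItem) := by
  simp only [IsMPartition, Finset.forall_mem_map, itemBox_swapItem, interior_preimage_swap]
  refine ⟨fun x hx => ?_, fun x hx y hy hxy => ?_, ?_⟩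
  · obtain ⟨ht, hs, hi⟩ := hP.1 x hx
    refine ⟨by simpa [swapItem] using ht, ?_, ?_⟩
    · exact (itemBox_swapItem x).trans_subset (preimage_mono hs)
    · change (interior (itemBox (swapItem x))).Nonempty
      rw [itemBox_swapItem, interior_preimage_swap]
      exact hi.preimage Prod.swap_surjective
  · rw [← preimage_inter, hP.2.1 x hx y hy fun h => hxy (h ▸ rfl), preimage_empty]
  · rw [← hP.2.2]
    ext u
    simp only [mem_iUnion, Finset.mem_map, exists_prop, mem_preimage]
    constructor
    · rintro ⟨_, ⟨z, hz, rfl⟩, hu⟩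
      exact ⟨z, hz, by rwa [itemBox_swapItem] at hu⟩
    · rintro ⟨z, hz, hu⟩
      exact ⟨_, ⟨z, hz, rfl⟩, by rwa [itemBox_swapItem]⟩

lemma IsFine.map_swapItem {δ : ℝ × ℝ → ℝ} {P : Finset ((ℝ × ℝ) × (ℝ × ℝ) × (ℝ × ℝ))}
    (hP : IsFine (δ ∘ Prod.swap) P) : IsFine δ (P.map swapItem) := by
  simp only [IsFine, Finset.forall_mem_map, itemBox_swapItem]
  intro x hx u hu
  have := hP x hx hu
  rw [Metric.mem_ball, Prod.dist_eq, max_comm] at this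
  exact this

lemma PropSM.comp_swap {Y : Type*} [NormedAddCommGroup Y]
    {a₁ b₁ a₂ b₂ : ℝ} {f : ℝ × ℝ → Y}
    (hf : PropSM ((a₁, a₂) : ℝ × ℝ) (b₁, b₂) f) :
    PropSM ((a₂, a₁) : ℝ × ℝ) (b₂, b₁) (f ∘ Prod.swap) := by
  intro ε hε
  obtain ⟨δ, hδ, h⟩ := hf ε hε
  refine ⟨δ ∘ Prod.swap, fun t ht => hδ t.swap (by rwa [Icc_prod_swap] at ht),
    fun P Q hP hPf hQ hQf => ?_⟩
  have hswap := h (P.map swapItem) (Q.map swapItem)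
    (by rw [Icc_prod_swap]; exact hP.map_swapItem) hPf.map_swapItem
    (by rw [Icc_prod_swap]; exact hQ.map_swapItem) hQf.map_swapItem
  simp only [Finset.sum_map, itemBox_swapItem, ← preimage_inter] at hswap
  refine lt_of_eq_of_lt (Finset.sum_congr rfl fun x _ => Finset.sum_congr rfl fun y _ => ?_) hswap
  rw [Measure.volume_eq_prod, (Measure.measurePreserving_swap (μ := (volume : Measure ℝ))
    (ν := (volume : Measure ℝ))).measure_preimage (s := itemBox x ∩ itemBox y)
      (measurableSet_Icc.inter measurableSet_Icc).nullMeasurableSet]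
  rfl

/-- Lemma 2.3(iii): `Z = (Z₁ × [a₂,b₂]) ∪ ([a₁,b₁] × Z₂)` is null in `[a,b]`. -/
theorem indicator_badSections_mcShane_integral_zero {X : Type*} [NormedAddCommGroup X] [NormedSpace ℝ X] [CompleteSpace X] (a₁ b₁ a₂ b₂ : ℝ) (hab₁ : a₁ < b₁) (hab₂ : a₂ < b₂)
    (f : ℝ × ℝ → X) (hf : PropSM ((a₁, a₂) : ℝ × ℝ) (b₁, b₂) f)
    (Z₁ : Set ℝ) (hZ₁ : Z₁ = {t₁ : ℝ | t₁ ∈ Set.Icc a₁ b₁ ∧ ¬ PropSM a₂ b₂ (fun s₂ => f (t₁, s₂))})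
    (Z₂ : Set ℝ) (hZ₂ : Z₂ = {t₂ : ℝ | t₂ ∈ Set.Icc a₂ b₂ ∧ ¬ PropSM a₁ b₁ (fun s₁ => f (s₁, t₂))})
    (Z : Set (ℝ × ℝ)) (hZ : Z = (Z₁ ×ˢ Set.Icc a₂ b₂) ∪ ((Set.Icc a₁ b₁) ×ˢ Z₂)) :
    HasMcShaneIntegral (Set.Icc ((a₁, a₂) : ℝ × ℝ) (b₁, b₂)) (Z.indicator (fun _ => (1 : ℝ))) 0 := by
  have hZ₁0 : volume Z₁ = 0 := hZ₁ ▸ hf.volume_setOf_not_section_eq_zero hab₁ hab₂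
  have hZ₂0 : volume Z₂ = 0 := hZ₂ ▸ hf.comp_swap.volume_setOf_not_section_eq_zero hab₂ hab₁
  refine hasMcShaneIntegral_indicator_of_null _ _ ?_
  rw [hZ, measure_union_null_iff, Measure.volume_eq_prod, Measure.prod_prod, Measure.prod_prod,
    hZ₁0, hZ₂0, zero_mul, mul_zero]
  exact ⟨rfl, rfl⟩
end

section
/- Let f : [a,b] → X have the property S*HK on [a,b] and let Z₂ = { t₂ ∈ [a₂,b₂] : the section f_{t₂} does not have the property S*HK on [a₁,b₁] }. Then the indicator function 𝟙_{Z₂} is Henstock–Kurzweil integrable on [a₂,b₂] with (HK)∫_{[a₂,b₂]} 𝟙_{Z₂} = 0. -/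
open Set MeasureTheory

variable {E : Type*} [MeasureSpace E] [PseudoMetricSpace E] [Preorder E]
variable {X : Type*} [NormedAddCommGroup X] [NormedSpace ℝ X]

theorem exists_pos_forall_le {ι : Type*} (P : Finset ι) (δ : ι → ℝ) (h : ∀ x ∈ P, 0 < δ x) :
    ∃ d > 0, ∀ x ∈ P, d ≤ δ x := by
  classical
  induction P using Finset.induction_on with
  | empty => exact ⟨1, one_pos, by simp⟩
  | insert a s _ ih =>
    obtain ⟨d, hd, hs⟩ := ih fun x hx => h x (Finset.mem_insert_of_mem hx)
    refine ⟨min d (δ a), lt_min hd (h a (Finset.mem_insert_self a s)), fun x hx => ?_⟩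
    rcases Finset.mem_insert.1 hx with rfl | hx
    · exact min_le_right _ _
    · exact (min_le_left _ _).trans (hs x hx)

/-- Cousin's lemma for predicates on intervals: a predicate that is closed under concatenation
and holds for all small intervals around each point holds for the whole interval. -/
theorem cousin_induction {p : ℝ → ℝ → Prop} {δ : ℝ → ℝ} {a b : ℝ} (hab : a < b)
    (hδ : IsGauge (Set.Icc a b) δ)
    (concat : ∀ c m d, a ≤ c → c < m → m < d → d ≤ b → p c m → p m d → p c d)
    (small : ∀ t c d, a ≤ c → c ≤ t → t ≤ d → d ≤ b → c < d →
      Set.Icc c d ⊆ Metric.ball t (δ t) → p c d) : p a b := by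
  set T : Set ℝ := {x | x ∈ Set.Icc a b ∧ (x = a ∨ p a x)}
  have haT : a ∈ T := ⟨⟨le_rfl, hab.le⟩, Or.inl rfl⟩
  have hbdd : BddAbove T := ⟨b, fun x hx => hx.1.2⟩
  set s := sSup T
  have has : a ≤ s := le_csSup hbdd haT
  have hsb : s ≤ b := csSup_le ⟨a, haT⟩ fun x hx => hx.1.2
  have hpos := hδ s ⟨has, hsb⟩
  obtain ⟨x, hxT, hx⟩ := exists_lt_of_lt_csSup ⟨a, haT⟩ (show s - δ s < s by linarith)
  have hxs : x ≤ s := le_csSup hbdd hxT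
  have extend : ∀ y, s ≤ y → y ≤ b → y < s + δ s → x < y → p a y := by
    intro y hsy hyb hys hxy
    have hball : Set.Icc x y ⊆ Metric.ball s (δ s) := by
      intro z hz
      rw [Real.ball_eq_Ioo]
      exact ⟨by linarith [hz.1], by linarith [hz.2]⟩
    have hxyp := small s x y hxT.1.1 hxs hsy hyb hxy hball
    rcases hxT.2 with rfl | hax
    · exact hxyp
    · rcases hxT.1.1.eq_or_lt with h | h
      · rwa [← h] at hxyp
      · exact concat a x y le_rfl h hxy hyb hax hxyp
  rcases hsb.eq_or_lt with h | h
  · rcases hxs.eq_or_lt with h' | h'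
    · rcases hxT.2 with h'' | h''
      · linarith
      · rwa [h', h] at h''
    · rw [← h]
      exact extend s le_rfl hsb (by linarith) h'
  · have hy : s < min b (s + δ s / 2) := lt_min h (by linarith)
    have hyT : min b (s + δ s / 2) ∈ T :=
      ⟨⟨by linarith, min_le_left _ _⟩, Or.inr (extend _ hy.le (min_le_left _ _)
        (lt_of_le_of_lt (min_le_right _ _) (by linarith)) (by linarith))⟩
    exact absurd (le_csSup hbdd hyT) (not_le.2 hy)

theorem isHKPartition_singleton {t c d : ℝ} (hcd : c < d) (ht : t ∈ Set.Icc c d) :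
    IsHKPartition (Set.Icc c d) {(t, c, d)} := by
  refine ⟨⟨?_, ?_, ?_⟩, ?_⟩
  · simp [IsSubinterval, ht.1, ht.2, interior_Icc, hcd]
  · simp
  · simp [itemBox]
  · simpa [itemBox] using ht

theorem interior_itemBox_subset {c d : ℝ} {P : Finset (ℝ × ℝ × ℝ)}
    (hP : IsHKPartition (Set.Icc c d) P) {x : ℝ × ℝ × ℝ} (hx : x ∈ P) :
    interior (itemBox x) ⊆ Set.Ioo c d := by
  rw [← interior_Icc]
  exact interior_mono (hP.1.1 x hx).2.1

theorem interior_itemBox_inter_eq_empty {c m d : ℝ} {P Q : Finset (ℝ × ℝ × ℝ)}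
    (hP : IsHKPartition (Set.Icc c m) P) (hQ : IsHKPartition (Set.Icc m d) Q)
    {x y : ℝ × ℝ × ℝ} (hx : x ∈ P) (hy : y ∈ Q) :
    interior (itemBox x) ∩ interior (itemBox y) = ∅ := by
  rw [Set.eq_empty_iff_forall_notMem]
  rintro z ⟨hzx, hzy⟩
  have h₁ := interior_itemBox_subset hP hx hzx
  have h₂ := interior_itemBox_subset hQ hy hzy
  exact lt_asymm h₁.2 h₂.1

theorem disjoint_of_isHKPartition {c m d : ℝ} {P Q : Finset (ℝ × ℝ × ℝ)}
    (hP : IsHKPartition (Set.Icc c m) P) (hQ : IsHKPartition (Set.Icc m d) Q) :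
    Disjoint P Q := by
  rw [Finset.disjoint_left]
  intro x hx hy
  have h := interior_itemBox_inter_eq_empty hP hQ hx hy
  rw [Set.inter_self] at h
  exact (hP.1.1 x hx).2.2.ne_empty h

theorem IsHKPartition.union {c m d : ℝ} (hcm : c ≤ m) (hmd : m ≤ d)
    {P Q : Finset (ℝ × ℝ × ℝ)}
    (hP : IsHKPartition (Set.Icc c m) P) (hQ : IsHKPartition (Set.Icc m d) Q) :
    IsHKPartition (Set.Icc c d) (P ∪ Q) := by
  have hl : Set.Icc c m ⊆ Set.Icc c d := Set.Icc_subset_Icc_right hmd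
  have hr : Set.Icc m d ⊆ Set.Icc c d := Set.Icc_subset_Icc_left hcm
  refine ⟨⟨?_, ?_, ?_⟩, ?_⟩
  · intro x hx
    rcases Finset.mem_union.1 hx with hx | hx
    · have h := hP.1.1 x hx
      exact ⟨hl h.1, h.2.1.trans hl, h.2.2⟩
    · have h := hQ.1.1 x hx
      exact ⟨hr h.1, h.2.1.trans hr, h.2.2⟩
  · intro x hx y hy hxy
    rcases Finset.mem_union.1 hx with hx | hx <;> rcases Finset.mem_union.1 hy with hy | hy
    · exact hP.1.2.1 x hx y hy hxy
    · exact interior_itemBox_inter_eq_empty hP hQ hx hy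
    · rw [Set.inter_comm]
      exact interior_itemBox_inter_eq_empty hP hQ hy hx
    · exact hQ.1.2.1 x hx y hy hxy
  · rw [Finset.set_biUnion_union, hP.1.2.2, hQ.1.2.2, Set.Icc_union_Icc_eq_Icc hcm hmd]
  · intro x hx
    rcases Finset.mem_union.1 hx with hx | hx
    · exact hP.2 x hx
    · exact hQ.2 x hx

theorem IsFine.union {δ : ℝ → ℝ} {P Q : Finset (ℝ × ℝ × ℝ)} (hP : IsFine δ P)
    (hQ : IsFine δ Q) : IsFine δ (P ∪ Q) := fun x hx =>
  (Finset.mem_union.1 hx).elim (hP x) (hQ x)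

/-- Cousin's lemma. -/
theorem exists_fine_isHKPartition {a b : ℝ} (hab : a < b) {δ : ℝ → ℝ}
    (hδ : IsGauge (Set.Icc a b) δ) :
    ∃ P, IsHKPartition (Set.Icc a b) P ∧ IsFine δ P := by
  refine cousin_induction (p := fun c d => ∃ P, IsHKPartition (Set.Icc c d) P ∧ IsFine δ P)
    hab hδ ?_ ?_
  · rintro c m d - hcm hmd - ⟨P, hP, hPδ⟩ ⟨Q, hQ, hQδ⟩
    exact ⟨P ∪ Q, hP.union hcm.le hmd.le hQ, hPδ.union hQδ⟩
  · intro t c d _ hct htd _ hcd hball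
    exact ⟨{(t, c, d)}, isHKPartition_singleton hcd ⟨hct, htd⟩, by simpa [IsFine, itemBox]⟩

/-- If the gauge is bounded below on `S`, some fine partition has its intervals with tags in `S`
of total length at least the outer measure of `S`. -/
theorem exists_fine_isHKPartition_volume_le {δ : ℝ → ℝ} (S : Set ℝ) (k : ℕ) :
    ∀ {c d : ℝ}, c < d → IsGauge (Set.Icc c d) δ → (∀ t ∈ S, (d - c) / 2 ^ k < δ t) →
    ∃ P, IsHKPartition (Set.Icc c d) P ∧ IsFine δ P ∧
      volume (S ∩ Set.Icc c d) ≤ ∑ x ∈ P, S.indicator (fun _ => volume (itemBox x)) x.1 := by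
  induction k with
  | zero =>
    intro c d hcd hδ hS
    rcases (S ∩ Set.Icc c d).eq_empty_or_nonempty with h | ⟨t, htS, ht⟩
    · obtain ⟨P, hP, hPδ⟩ := exists_fine_isHKPartition hcd hδ
      exact ⟨P, hP, hPδ, by simp [h]⟩
    · refine ⟨{(t, c, d)}, isHKPartition_singleton hcd ht, ?_, ?_⟩
      · have h := hS t htS
        simp only [IsFine, Finset.mem_singleton, forall_eq, itemBox, Real.ball_eq_Ioo]
        intro z hz
        rw [pow_zero, div_one] at h
        exact ⟨by linarith [hz.1, ht.2], by linarith [hz.2, ht.1]⟩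
      · simpa [htS, itemBox] using
          measure_mono (μ := volume) (inter_subset_right : S ∩ Set.Icc c d ⊆ _)
  | succ k ih =>
    intro c d hcd hδ hS
    have hcm : c < (c + d) / 2 := by linarith
    have hmd : (c + d) / 2 < d := by linarith
    have e₁ : ((c + d) / 2 - c) / 2 ^ k = (d - c) / 2 ^ (k + 1) := by
      rw [pow_succ]; field_simp; ring
    have e₂ : (d - (c + d) / 2) / 2 ^ k = (d - c) / 2 ^ (k + 1) := by
      rw [pow_succ]; field_simp; ring
    obtain ⟨P, hP, hPδ, hPS⟩ := ih hcm
      (fun t ht => hδ t (Set.Icc_subset_Icc_right hmd.le ht)) (by rwa [e₁])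
    obtain ⟨Q, hQ, hQδ, hQS⟩ := ih hmd
      (fun t ht => hδ t (Set.Icc_subset_Icc_left hcm.le ht)) (by rwa [e₂])
    refine ⟨P ∪ Q, hP.union hcm.le hmd.le hQ, hPδ.union hQδ, ?_⟩
    rw [Finset.sum_union (disjoint_of_isHKPartition hP hQ),
      ← Set.Icc_union_Icc_eq_Icc hcm.le hmd.le, Set.inter_union_distrib_left]
    exact (measure_union_le _ _).trans (add_le_add hPS hQS)

theorem volume_itemBox_ne_top_s12 (x : ℝ × ℝ × ℝ) : volume (itemBox x) ≠ ⊤ := by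
  simp [itemBox]

/-- A nonnegative function with Henstock–Kurzweil integral zero is bounded below by a positive
constant only on null sets. -/
theorem volume_eq_zero_of_hasHKIntegral_zero {a b : ℝ} (hab : a < b) {g : ℝ → ℝ}
    (hg : ∀ t, 0 ≤ g t) (h : HasHKIntegral (Set.Icc a b) g 0) {S : Set ℝ}
    (hSab : S ⊆ Set.Icc a b) {r : ℝ} (hr : 0 < r) (hS : ∀ t ∈ S, r ≤ g t) : volume S = 0 := by
  refine le_antisymm (ENNReal.le_of_forall_pos_le_add fun η hη _ => ?_) zero_le
  obtain ⟨δ, hδ, hδP⟩ := h (r * η) (mul_pos hr hη)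
  set A : ℕ → Set ℝ := fun k => {t ∈ S | (b - a) / 2 ^ k < δ t}
  have hmono : Monotone A := by
    intro k l hkl t ht
    refine ⟨ht.1, lt_of_le_of_lt ?_ ht.2⟩
    have : 0 ≤ b - a := by linarith
    gcongr
    norm_num
  have hunion : S = ⋃ k, A k := by
    refine Set.Subset.antisymm (fun t ht => ?_) (Set.iUnion_subset fun k t ht => ht.1)
    have hpos := hδ t (hSab ht)
    obtain ⟨k, hk⟩ := pow_unbounded_of_one_lt ((b - a) / δ t) (one_lt_two : (1 : ℝ) < 2)
    refine Set.mem_iUnion.2 ⟨k, ht, ?_⟩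
    rw [div_lt_iff₀ (by positivity)]
    rw [div_lt_iff₀ hpos] at hk
    linarith
  rw [hunion, hmono.measure_iUnion, zero_add]
  refine iSup_le fun k => ?_
  obtain ⟨P, hP, hPδ, hPA⟩ := exists_fine_isHKPartition_volume_le (A k) k hab hδ fun t ht => ht.2
  rw [Set.inter_eq_left.2 fun t ht => hSab ht.1] at hPA
  refine hPA.trans ?_
  have hne : ∀ x ∈ P, (A k).indicator (fun _ => volume (itemBox x)) x.1 ≠ ⊤ := by
    intro x _
    by_cases hx : x.1 ∈ A k <;> simp [hx, volume_itemBox_ne_top_s12]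
  rw [← ENNReal.ofReal_coe_nnreal]
  refine (ENNReal.le_ofReal_iff_toReal_le (ENNReal.sum_ne_top.2 hne) η.2).2 ?_
  rw [ENNReal.toReal_sum hne]
  have hlt := hδP P hP hPδ
  rw [sub_zero] at hlt
  refine le_of_mul_le_mul_left (le_trans ?_ ((le_abs_self _).trans hlt.le)) hr
  rw [Finset.mul_sum]
  refine Finset.sum_le_sum fun x _ => ?_
  by_cases hx : x.1 ∈ A k
  · simpa [hx, mul_comm] using
      mul_le_mul_of_nonneg_left (hS x.1 hx.1) (ENNReal.toReal_nonneg (a := volume (itemBox x)))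
  · simpa [hx] using mul_nonneg ENNReal.toReal_nonneg (hg x.1)

theorem hasHKIntegral_indicator_of_volume_eq_zero {a b : ℝ} {Z : Set ℝ} (hZ : volume Z = 0) :
    HasHKIntegral (Set.Icc a b) (Z.indicator fun _ => (1 : ℝ)) 0 := by
  classical
  intro ε hε
  obtain ⟨U, hZU, hU, hUε⟩ :=
    Z.exists_isOpen_lt_of_lt (ENNReal.ofReal ε) (μ := volume) (by simpa [hZ])
  have hball : ∀ t, ∃ d > 0, t ∈ U → Metric.ball t d ⊆ U := by
    intro t
    by_cases ht : t ∈ U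
    · obtain ⟨d, hd, h⟩ := Metric.isOpen_iff.1 hU t ht
      exact ⟨d, hd, fun _ => h⟩
    · exact ⟨1, one_pos, fun h => absurd h ht⟩
  choose δ hδ hδU using hball
  refine ⟨δ, fun t _ => hδ t, fun P hP hPδ => ?_⟩
  set R := P.filter fun x => x.1 ∈ Z
  have hsum : ∑ x ∈ P, (volume (itemBox x)).toReal • Z.indicator (fun _ => (1 : ℝ)) x.1
      = ∑ x ∈ R, (volume (itemBox x)).toReal := by
    rw [Finset.sum_filter]
    refine Finset.sum_congr rfl fun x _ => ?_
    by_cases hx : x.1 ∈ Z <;> simp [hx]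
  have hvol : ∑ x ∈ R, volume (itemBox x) ≤ volume U := by
    have hint : ∀ x ∈ R, volume (itemBox x) = volume (interior (itemBox x)) := by
      intro x _
      simp [itemBox, interior_Icc]
    rw [Finset.sum_congr rfl hint, ← measure_biUnion_finset]
    · refine measure_mono (Set.iUnion₂_subset fun x hx => interior_subset.trans ?_)
      obtain ⟨hxP, hxZ⟩ := Finset.mem_filter.1 hx
      exact (hPδ x hxP).trans (hδU x.1 (hZU hxZ))
    · intro x hx y hy hxy
      exact Set.disjoint_iff_inter_eq_empty.2
        (hP.1.2.1 x (Finset.mem_filter.1 hx).1 y (Finset.mem_filter.1 hy).1 hxy)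
    · exact fun x _ => isOpen_interior.measurableSet
  rw [hsum, sub_zero, Real.norm_of_nonneg (Finset.sum_nonneg fun _ _ => ENNReal.toReal_nonneg),
    ← ENNReal.toReal_sum fun x _ => volume_itemBox_ne_top_s12 x]
  exact ENNReal.toReal_lt_of_lt_ofReal (hvol.trans_lt hUε)

/-- The product of a tagged interval `(s, I)` in the first variable with a tagged interval
`(t, J)` in the second one; the argument lists `(t, J)` first. -/
def prodItem (z : (_ : ℝ × ℝ × ℝ) × (ℝ × ℝ × ℝ)) : (ℝ × ℝ) × (ℝ × ℝ) × (ℝ × ℝ) :=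
  ((z.2.1, z.1.1), (z.2.2.1, z.1.2.1), (z.2.2.2, z.1.2.2))

theorem prodItem_injective : Function.Injective prodItem := by
  rintro ⟨⟨t, u, v⟩, s, p, q⟩ ⟨⟨t', u', v'⟩, s', p', q'⟩ h
  simp only [prodItem, Prod.mk.injEq] at h
  obtain ⟨⟨rfl, rfl⟩, ⟨rfl, rfl⟩, rfl, rfl⟩ := h
  rfl

theorem itemBox_prodItem (z : (_ : ℝ × ℝ × ℝ) × (ℝ × ℝ × ℝ)) :
    itemBox (prodItem z) = itemBox z.2 ×ˢ itemBox z.1 := by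
  rw [itemBox, Set.Icc_prod_eq]
  rfl

/-- The partition of a rectangle made of a partition `R` of the second side and, over each
interval of `R` with tag `t`, the partition `P t` of the first side. -/
def fiberPartition (R : Finset (ℝ × ℝ × ℝ)) (P : ℝ → Finset (ℝ × ℝ × ℝ)) :
    Finset ((ℝ × ℝ) × (ℝ × ℝ) × (ℝ × ℝ)) :=
  (R.sigma fun r => P r.1).map ⟨prodItem, prodItem_injective⟩

theorem mem_fiberPartition {R : Finset (ℝ × ℝ × ℝ)} {P : ℝ → Finset (ℝ × ℝ × ℝ)}
    {x : (ℝ × ℝ) × (ℝ × ℝ) × (ℝ × ℝ)} :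
    x ∈ fiberPartition R P ↔ ∃ r ∈ R, ∃ y ∈ P r.1, prodItem ⟨r, y⟩ = x := by
  simp only [fiberPartition, Finset.mem_map, Finset.mem_sigma, Function.Embedding.coeFn_mk]
  constructor
  · rintro ⟨⟨r, y⟩, ⟨hr, hy⟩, h⟩
    exact ⟨r, hr, y, hy, h⟩
  · rintro ⟨r, hr, y, hy, h⟩
    exact ⟨⟨r, y⟩, ⟨hr, hy⟩, h⟩

theorem isHKPartition_fiberPartition {a₁ b₁ a₂ b₂ : ℝ} {R : Finset (ℝ × ℝ × ℝ)}
    {P : ℝ → Finset (ℝ × ℝ × ℝ)} (hR : IsHKPartition (Set.Icc a₂ b₂) R)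
    (hP : ∀ t ∈ Set.Icc a₂ b₂, IsHKPartition (Set.Icc a₁ b₁) (P t)) :
    IsHKPartition (Set.Icc ((a₁, a₂) : ℝ × ℝ) (b₁, b₂)) (fiberPartition R P) := by
  have hPR : ∀ r ∈ R, IsHKPartition (Set.Icc a₁ b₁) (P r.1) := fun r hr => hP _ (hR.1.1 r hr).1
  rw [Set.Icc_prod_eq]
  refine ⟨⟨?_, ?_, ?_⟩, ?_⟩
  · intro x hx
    obtain ⟨r, hr, y, hy, rfl⟩ := mem_fiberPartition.1 hx
    have h₂ := hR.1.1 r hr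
    have h₁ := (hPR r hr).1.1 y hy
    refine ⟨⟨h₁.1, h₂.1⟩, ?_⟩
    have hbox := itemBox_prodItem ⟨r, y⟩
    refine ⟨?_, ?_⟩
    · change itemBox (prodItem ⟨r, y⟩) ⊆ _
      rw [hbox]
      exact Set.prod_mono h₁.2.1 h₂.2.1
    · change (interior (itemBox (prodItem ⟨r, y⟩))).Nonempty
      rw [hbox, interior_prod_eq]
      exact h₁.2.2.prod h₂.2.2
  · intro x hx x' hx' hne
    obtain ⟨r, hr, y, hy, rfl⟩ := mem_fiberPartition.1 hx
    obtain ⟨r', hr', y', hy', rfl⟩ := mem_fiberPartition.1 hx'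
    rw [itemBox_prodItem, itemBox_prodItem, interior_prod_eq, interior_prod_eq,
      Set.prod_inter_prod, Set.prod_eq_empty_iff]
    by_cases hrr : r = r'
    · subst hrr
      refine Or.inl ((hPR r hr).1.2.1 y hy y' hy' ?_)
      rintro rfl
      exact hne rfl
    · exact Or.inr (hR.1.2.1 r hr r' hr' hrr)
  · ext ⟨s, t⟩
    simp only [Set.mem_iUnion, exists_prop]
    constructor
    · rintro ⟨x, hx, hst⟩
      obtain ⟨r, hr, y, hy, rfl⟩ := mem_fiberPartition.1 hx
      rw [itemBox_prodItem] at hst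
      exact ⟨((hPR r hr).1.1 y hy).2.1 hst.1, (hR.1.1 r hr).2.1 hst.2⟩
    · rintro ⟨hs, ht⟩
      rw [← hR.1.2.2] at ht
      obtain ⟨r, hr, htr⟩ := Set.mem_iUnion₂.1 ht
      rw [← (hPR r hr).1.2.2] at hs
      obtain ⟨y, hy, hsy⟩ := Set.mem_iUnion₂.1 hs
      refine ⟨_, mem_fiberPartition.2 ⟨r, hr, y, hy, rfl⟩, ?_⟩
      rw [itemBox_prodItem]
      exact ⟨hsy, htr⟩
  · intro x hx
    obtain ⟨r, hr, y, hy, rfl⟩ := mem_fiberPartition.1 hx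
    rw [itemBox_prodItem]
    exact ⟨(hPR r hr).2 y hy, hR.2 r hr⟩

theorem isFine_fiberPartition {δ : ℝ × ℝ → ℝ} {δ₂ : ℝ → ℝ} {R : Finset (ℝ × ℝ × ℝ)}
    {P : ℝ → Finset (ℝ × ℝ × ℝ)} (hR : IsFine δ₂ R)
    (hP : ∀ r ∈ R, IsFine (fun s => δ (s, r.1)) (P r.1))
    (hδ : ∀ r ∈ R, ∀ y ∈ P r.1, δ₂ r.1 ≤ δ (y.1, r.1)) :
    IsFine δ (fiberPartition R P) := by
  intro x hx
  obtain ⟨r, hr, y, hy, rfl⟩ := mem_fiberPartition.1 hx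
  rw [itemBox_prodItem]
  change _ ⊆ Metric.ball (y.1, r.1) (δ (y.1, r.1))
  rw [← ball_prod_same]
  exact Set.prod_mono (hP r hr y hy)
    ((hR r hr).trans (Metric.ball_subset_ball (hδ r hr y hy)))

/-- Keeping only the pairs over a common interval of `R` bounds the double sum of the definition
of `PropSHK` from below by a Riemann sum of the double sums of the sections. -/
theorem sum_sections_le_sum_fiberPartition {X : Type*} [NormedAddCommGroup X] (f : ℝ × ℝ → X)
    (R : Finset (ℝ × ℝ × ℝ)) (P Q : ℝ → Finset (ℝ × ℝ × ℝ)) :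
    ∑ r ∈ R, (volume (itemBox r)).toReal * ∑ x ∈ P r.1, ∑ y ∈ Q r.1,
        ‖f (x.1, r.1) - f (y.1, r.1)‖ * (volume (itemBox x ∩ itemBox y)).toReal ≤
      ∑ x ∈ fiberPartition R P, ∑ y ∈ fiberPartition R Q,
        ‖f x.1 - f y.1‖ * (volume (itemBox x ∩ itemBox y)).toReal := by
  simp only [fiberPartition, Finset.sum_map, Function.Embedding.coeFn_mk, Finset.sum_sigma]
  refine Finset.sum_le_sum fun r hr => ?_
  rw [Finset.mul_sum]
  refine Finset.sum_le_sum fun x _ => ?_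
  refine le_trans (le_of_eq ?_) (Finset.single_le_sum (f := fun r' => ∑ y ∈ Q r'.1,
    ‖f (prodItem ⟨r, x⟩).1 - f (prodItem ⟨r', y⟩).1‖ *
      (volume (itemBox (prodItem ⟨r, x⟩) ∩ itemBox (prodItem ⟨r', y⟩))).toReal)
    (fun r' _ => Finset.sum_nonneg fun y _ => by positivity) hr)
  rw [Finset.mul_sum]
  refine Finset.sum_congr rfl fun y _ => ?_
  rw [itemBox_prodItem, itemBox_prodItem, Set.prod_inter_prod, Set.inter_self,
    Measure.volume_eq_prod, Measure.prod_prod, ENNReal.toReal_mul]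
  simp only [prodItem]
  ring

/-- If each section of `f` admits, for every gauge, a pair of fine partitions with double sum at
least `g t ≥ 0`, then `g` has Henstock–Kurzweil integral zero. -/
theorem hasHKIntegral_zero_of_le_section_sums {X : Type*} [NormedAddCommGroup X]
    [NormedSpace ℝ X] {a₁ b₁ a₂ b₂ : ℝ} {f : ℝ × ℝ → X}
    (hf : PropSHK ((a₁, a₂) : ℝ × ℝ) (b₁, b₂) f) {g : ℝ → ℝ} (hg : ∀ t, 0 ≤ g t)
    (h : ∀ t ∈ Set.Icc a₂ b₂, ∀ γ : ℝ → ℝ, IsGauge (Set.Icc a₁ b₁) γ →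
      ∃ P Q, IsHKPartition (Set.Icc a₁ b₁) P ∧ IsFine γ P ∧
        IsHKPartition (Set.Icc a₁ b₁) Q ∧ IsFine γ Q ∧
        g t ≤ ∑ x ∈ P, ∑ y ∈ Q,
          ‖f (x.1, t) - f (y.1, t)‖ * (volume (itemBox x ∩ itemBox y)).toReal) :
    HasHKIntegral (Set.Icc a₂ b₂) g 0 := by
  intro η hη
  obtain ⟨δ, hδ, hδη⟩ := hf η hη
  rw [Set.Icc_prod_eq] at hδ
  have key : ∀ t, ∃ P Q : Finset (ℝ × ℝ × ℝ), ∃ d : ℝ, t ∈ Set.Icc a₂ b₂ →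
      0 < d ∧ (∀ x ∈ P, d ≤ δ (x.1, t)) ∧ (∀ x ∈ Q, d ≤ δ (x.1, t)) ∧
      IsHKPartition (Set.Icc a₁ b₁) P ∧ IsFine (fun s => δ (s, t)) P ∧
      IsHKPartition (Set.Icc a₁ b₁) Q ∧ IsFine (fun s => δ (s, t)) Q ∧
      g t ≤ ∑ x ∈ P, ∑ y ∈ Q,
        ‖f (x.1, t) - f (y.1, t)‖ * (volume (itemBox x ∩ itemBox y)).toReal := by
    intro t
    by_cases ht : t ∈ Set.Icc a₂ b₂
    · obtain ⟨P, Q, hP, hPδ, hQ, hQδ, hle⟩ := h t ht (fun s => δ (s, t))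
        fun s hs => hδ (s, t) ⟨hs, ht⟩
      obtain ⟨d, hd, hdP⟩ := exists_pos_forall_le P (fun x => δ (x.1, t))
        fun x hx => hδ (x.1, t) ⟨(hP.1.1 x hx).1, ht⟩
      obtain ⟨e, he, heQ⟩ := exists_pos_forall_le Q (fun x => δ (x.1, t))
        fun x hx => hδ (x.1, t) ⟨(hQ.1.1 x hx).1, ht⟩
      exact ⟨P, Q, min d e, fun _ => ⟨lt_min hd he,
        fun x hx => (min_le_left _ _).trans (hdP x hx),
        fun x hx => (min_le_right _ _).trans (heQ x hx), hP, hPδ, hQ, hQδ, hle⟩⟩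
    · exact ⟨∅, ∅, 1, fun h => absurd h ht⟩
  choose P Q δ₂ hkey using key
  refine ⟨δ₂, fun t ht => (hkey t ht).1, fun R hR hRδ => ?_⟩
  have hmem : ∀ r ∈ R, r.1 ∈ Set.Icc a₂ b₂ := fun r hr => (hR.1.1 r hr).1
  have hlt := hδη (fiberPartition R P) (fiberPartition R Q)
    (isHKPartition_fiberPartition hR fun t ht => (hkey t ht).2.2.2.1)
    (isFine_fiberPartition hRδ (fun r hr => (hkey r.1 (hmem r hr)).2.2.2.2.1)
      fun r hr => (hkey r.1 (hmem r hr)).2.1)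
    (isHKPartition_fiberPartition hR fun t ht => (hkey t ht).2.2.2.2.2.1)
    (isFine_fiberPartition hRδ (fun r hr => (hkey r.1 (hmem r hr)).2.2.2.2.2.2.1)
      fun r hr => (hkey r.1 (hmem r hr)).2.2.1)
  simp only [smul_eq_mul]
  rw [sub_zero, Real.norm_of_nonneg
    (Finset.sum_nonneg fun r _ => mul_nonneg ENNReal.toReal_nonneg (hg r.1))]
  refine lt_of_le_of_lt ?_ ((sum_sections_le_sum_fiberPartition f R P Q).trans_lt hlt)
  exact Finset.sum_le_sum fun r hr => mul_le_mul_of_nonneg_left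
    (hkey r.1 (hmem r hr)).2.2.2.2.2.2.2 ENNReal.toReal_nonneg

/-- Lemma 2.3(ii): the set of `t₂` whose section fails the `𝓢*` property is null. -/
theorem indicator_badSectionsSnd_hk_integral_zero {X : Type*} [NormedAddCommGroup X] [NormedSpace ℝ X] [CompleteSpace X] (a₁ b₁ a₂ b₂ : ℝ) (hab₁ : a₁ < b₁) (hab₂ : a₂ < b₂)
    (f : ℝ × ℝ → X) (hf : PropSHK ((a₁, a₂) : ℝ × ℝ) (b₁, b₂) f)
    (Z₂ : Set ℝ) (hZ₂ : Z₂ = {t₂ : ℝ | t₂ ∈ Set.Icc a₂ b₂ ∧ ¬ PropSHK a₁ b₁ (fun s₁ => f (s₁, t₂))}) :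
    HasHKIntegral (Set.Icc a₂ b₂) (Z₂.indicator (fun _ => (1 : ℝ))) 0 := by
  have hchoice : ∀ t, ∃ e : ℝ, 0 ≤ e ∧ (t ∈ Z₂ → 0 < e) ∧
      (t ∈ Set.Icc a₂ b₂ → ∀ γ : ℝ → ℝ, IsGauge (Set.Icc a₁ b₁) γ →
        ∃ P Q, IsHKPartition (Set.Icc a₁ b₁) P ∧ IsFine γ P ∧
          IsHKPartition (Set.Icc a₁ b₁) Q ∧ IsFine γ Q ∧
          e ≤ ∑ x ∈ P, ∑ y ∈ Q,
            ‖f (x.1, t) - f (y.1, t)‖ * (volume (itemBox x ∩ itemBox y)).toReal) := by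
    intro t
    by_cases ht : t ∈ Z₂
    · have hbad : ¬ PropSHK a₁ b₁ fun s₁ => f (s₁, t) := by
        rw [hZ₂] at ht
        exact ht.2
      unfold PropSHK at hbad
      push Not at hbad
      obtain ⟨e, he, hbad⟩ := hbad
      refine ⟨e, he.le, fun _ => he, fun _ γ hγ => ?_⟩
      obtain ⟨P, Q, hP, hPγ, hQ, hQγ, hle⟩ := hbad γ hγ
      exact ⟨P, Q, hP, hPγ, hQ, hQγ, hle⟩
    · refine ⟨0, le_rfl, fun h => absurd h ht, fun _ γ hγ => ?_⟩
      obtain ⟨P, hP, hPγ⟩ := exists_fine_isHKPartition hab₁ hγ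
      exact ⟨P, P, hP, hPγ, hP, hPγ,
        Finset.sum_nonneg fun _ _ => Finset.sum_nonneg fun _ _ => by positivity⟩
  choose g hg hgZ hgsum using hchoice
  have hint := hasHKIntegral_zero_of_le_section_sums hf hg hgsum
  have hZsub : Z₂ ⊆ Set.Icc a₂ b₂ := by
    rw [hZ₂]
    exact fun t ht => ht.1
  refine hasHKIntegral_indicator_of_volume_eq_zero (measure_mono_null (fun t ht => ?_)
    (measure_iUnion_null fun n : ℕ => volume_eq_zero_of_hasHKIntegral_zero hab₂ hg hint
      (S := {t ∈ Z₂ | 1 / ((n : ℝ) + 1) ≤ g t}) (fun t ht => hZsub ht.1)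
      (Nat.one_div_pos_of_nat (α := ℝ) (n := n)) fun t ht => ht.2))
  obtain ⟨n, hn⟩ := exists_nat_one_div_lt (hgZ t ht)
  exact Set.mem_iUnion.2 ⟨n, ht, hn.le⟩
end
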